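/- Assmus–Mattson theorem for the Hamming association scheme (Tanaka): Let X be a finite set with q = |X| ≥ 2, fix x₀ ∈ X and n ≥ 2, and let C ⊆ X^n with 1 < |C| < q^n. Let δ = min{i : 1 ≤ i ≤ n and some x ∈ C has wt(x) = i} and δ* = min{i : 1 ≤ i ≤ n, B_i ≠ 0}. Suppose an integer t with 1 ≤ t ≤ n is such that for every r with 1 ≤ r ≤ t at least one of the following holds (inequalities of integers): (a) |{i : r ≤ i ≤ n−r and some x ∈ C has wt(x) = i}| ≤ δ* − r; (b) |{i : r ≤ i ≤ n−r, B_i ≠ 0}| ≤ δ − r. Then for every i with 0 ≤ i ≤ n, the multiset {supp(x) : x ∈ C, wt(x) = i} is a t-design with blocks of size i. -/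

import Mathlib

open Finset
open scoped Classical

noncomputable section

/-- Weight of a word relative to the base element `x₀`. -/
def wt {X : Type} [DecidableEq X] {n : ℕ} (x₀ : X) (x : Fin n → X) : ℕ :=
  (univ.filter fun ℓ => x ℓ ≠ x₀).card

/-- Support of a word relative to the base element `x₀`. -/
def supp {X : Type} [DecidableEq X] {n : ℕ} (x₀ : X) (x : Fin n → X) : Finset (Fin n) :=
  univ.filter fun ℓ => x ℓ ≠ x₀

/-- The Krawtchouk number `K_i(j)` for the Hamming scheme `H(n,q)`. -/
def kraw (q n i j : ℕ) : ℝ :=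
  ∑ h ∈ Finset.range (i + 1),
    (-1 : ℝ) ^ h * ((q : ℝ) - 1) ^ (i - h) * (j.choose h : ℝ) * ((n - j).choose (i - h) : ℝ)

open Polynomial in
/-- A polynomial with at most `d` monomials that vanishes to order `d` at `1` is zero. -/
theorem eq_zero_of_card_support_le {d : ℕ} {p : ℝ[X]} (hd : (1 - X) ^ d ∣ p)
    (hc : p.support.card ≤ d) : p = 0 := by
  induction d generalizing p with
  | zero => simpa using hc
  | succ d ih =>
    by_contra hp
    obtain ⟨j, hj⟩ : p.support.Nonempty := by simpa [Finset.nonempty_iff_ne_empty] using hp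
    have hcoeff : ∀ i : ℕ, (X * derivative p - C (j : ℝ) * p).coeff i = ((i : ℝ) - j) * p.coeff i := by
      intro i
      cases i with
      | zero => simp
      | succ i => simp [coeff_X_mul, coeff_derivative]; ring
    have hT : X * derivative p - C (j : ℝ) * p = 0 := by
      apply ih
      · refine dvd_sub (Dvd.dvd.mul_left ?_ _)
          (Dvd.dvd.mul_left ((pow_dvd_pow _ (Nat.le_succ d)).trans hd) _)
        simpa using pow_sub_one_dvd_derivative_of_pow_dvd hd
      · have hsub : (X * derivative p - C (j : ℝ) * p).support ⊆ p.support.erase j := by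
          intro i hi
          rw [mem_support_iff, hcoeff] at hi
          rw [Finset.mem_erase, mem_support_iff]
          refine ⟨?_, right_ne_zero_of_mul hi⟩
          rintro rfl
          simp at hi
        have h1 := Finset.card_le_card hsub
        rw [Finset.card_erase_of_mem hj] at h1
        omega
    have hmono : p = C (p.coeff j) * X ^ j := by
      ext i
      rw [coeff_C_mul_X_pow]
      split_ifs with hij
      · rw [hij]
      · have h1 := hcoeff i
        rw [hT, coeff_zero, eq_comm, mul_eq_zero, sub_eq_zero] at h1
        exact h1.resolve_left (by exact_mod_cast hij)
    have h1 : p.eval 1 = 0 := by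
      obtain ⟨s, rfl⟩ := hd
      simp
    rw [hmono] at h1
    simp at h1
    exact (mem_support_iff.1 hj) h1

open Polynomial in
/-- The MacWilliams transform of a sequence `a₀, …, a_N`. -/
def macWilliams (q : ℝ) (N : ℕ) (a : ℕ → ℝ) : ℝ[X] :=
  ∑ j ∈ range (N + 1), C (a j) * ((1 + C (q - 1) * X) ^ (N - j) * (1 - X) ^ j)

open Polynomial in
theorem natDegree_macWilliams_le (q : ℝ) (N : ℕ) (a : ℕ → ℝ) :
    (macWilliams q N a).natDegree ≤ N := by
  refine natDegree_sum_le_of_forall_le _ _ fun j hj => ?_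
  have h1 : (1 + C (q - 1) * X : ℝ[X]).natDegree ≤ 1 := by compute_degree
  have h2 : (1 - X : ℝ[X]).natDegree ≤ 1 := by compute_degree
  have h3 := natDegree_mul_le_of_le (natDegree_pow_le_of_le (N - j) h1)
    (natDegree_pow_le_of_le j h2)
  refine (natDegree_C_mul_le _ _).trans (h3.trans ?_)
  have := mem_range.1 hj
  omega

open Polynomial in
/-- The MacWilliams transform is an involution up to the factor `q ^ N`. -/
theorem macWilliams_macWilliams (q : ℝ) (N : ℕ) (a : ℕ → ℝ) :
    macWilliams q N (macWilliams q N a).coeff =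
      C (q ^ N) * ∑ j ∈ range (N + 1), C (a j) * X ^ j := by
  apply eq_of_infinite_eval_eq
  have hfin : {ρ : ℝ | 1 + (q - 1) * ρ = 0}.Finite := by
    refine (Set.finite_singleton (-1 / (q - 1))).subset fun ρ hρ => ?_
    have hρ' : 1 + (q - 1) * ρ = 0 := hρ
    have hq : q - 1 ≠ 0 := by
      intro h
      simp [h] at hρ'
    rw [Set.mem_singleton_iff, eq_div_iff hq]
    linarith
  refine hfin.infinite_compl.mono fun ρ hρ => ?_
  have hu : 1 + (q - 1) * ρ ≠ 0 := hρ
  set u := 1 + (q - 1) * ρ with hu_def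
  have hhom : ∑ i ∈ range (N + 1), (macWilliams q N a).coeff i * (u ^ (N - i) * (1 - ρ) ^ i) =
      u ^ N * (macWilliams q N a).eval ((1 - ρ) / u) := by
    rw [eval_eq_sum_range' (Nat.lt_succ_of_le (natDegree_macWilliams_le q N a)), mul_sum]
    refine sum_congr rfl fun i hi => ?_
    have hi' : i ≤ N := Nat.lt_succ_iff.1 (mem_range.1 hi)
    rw [div_pow, pow_sub₀ _ hu hi']
    field_simp
  have hleft : (macWilliams q N (macWilliams q N a).coeff).eval ρ =
      u ^ N * (macWilliams q N a).eval ((1 - ρ) / u) := by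
    rw [← hhom, macWilliams, eval_finsetSum]
    simp [hu_def]
  show eval ρ _ = eval ρ _
  rw [hleft, macWilliams, eval_finsetSum, eval_mul, eval_finsetSum, mul_sum, mul_sum]
  refine sum_congr rfl fun j hj => ?_
  obtain ⟨m, rfl⟩ := Nat.exists_eq_add_of_le (Nat.lt_succ_iff.1 (mem_range.1 hj))
  have h1 : 1 + (q - 1) * ((1 - ρ) / u) = q / u := by
    field_simp
    rw [hu_def]
    ring
  have h2 : 1 - (1 - ρ) / u = q * ρ / u := by
    field_simp
    rw [hu_def]
    ring
  simp only [eval_mul, eval_C, eval_pow, eval_add, eval_sub, eval_one, eval_X, h1, h2,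
    Nat.add_sub_cancel_left]
  rw [div_pow, div_pow, pow_add, pow_add]
  field_simp
  ring

open Polynomial in
theorem one_sub_pow_dvd_macWilliams {q : ℝ} {N d : ℕ} {a : ℕ → ℝ} (ha : ∀ j < d, a j = 0) :
    (1 - X) ^ d ∣ macWilliams q N a := by
  refine Finset.dvd_sum fun j _ => ?_
  rcases lt_or_ge j d with h | h
  · simp [ha j h]
  · exact ((pow_dvd_pow _ h).mul_left _).mul_left _

open Polynomial in
theorem eq_zero_of_macWilliams_macWilliams_eq_zero {q : ℝ} (hq : q ≠ 0) {N : ℕ} {a : ℕ → ℝ}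
    (h : macWilliams q N (macWilliams q N a).coeff = 0) {j : ℕ} (hj : j ≤ N) : a j = 0 := by
  rw [macWilliams_macWilliams, mul_eq_zero] at h
  have h1 := h.resolve_left (by simpa using fun h => absurd h hq)
  have h2 := congrArg (fun p => p.coeff j) h1
  simpa [finsetSum_coeff, coeff_C_mul, coeff_X_pow, Nat.lt_succ_iff, hj] using h2

open Polynomial in
/-- If the first `d` terms of a sequence vanish and its transform has at most `d` monomials,
then the sequence vanishes. -/
theorem eq_zero_of_card_support_macWilliams_le {q : ℝ} (hq : q ≠ 0) {N d : ℕ} {a : ℕ → ℝ}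
    (ha : ∀ j < d, a j = 0) (hc : (macWilliams q N a).support.card ≤ d) {j : ℕ} (hj : j ≤ N) :
    a j = 0 := by
  have h0 := eq_zero_of_card_support_le (one_sub_pow_dvd_macWilliams ha) hc
  exact eq_zero_of_macWilliams_macWilliams_eq_zero hq (by rw [h0]; simp [macWilliams]) hj

open Polynomial in
/-- If a sequence has at most `d` nonzero terms and its transform vanishes to order `d` at `0`,
then the sequence vanishes. -/
theorem eq_zero_of_coeff_macWilliams_eq_zero {q : ℝ} (hq : q ≠ 0) {N d : ℕ} {a : ℕ → ℝ}
    (hc : ∀ i < d, (macWilliams q N a).coeff i = 0)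
    (ha : ((range (N + 1)).filter fun j => a j ≠ 0).card ≤ d) {j : ℕ} (hj : j ≤ N) :
    a j = 0 := by
  refine eq_zero_of_macWilliams_macWilliams_eq_zero hq
    (eq_zero_of_card_support_le (one_sub_pow_dvd_macWilliams hc) (le_trans ?_ ha)) hj
  refine card_le_card fun i hi => ?_
  rw [mem_support_iff, macWilliams_macWilliams, coeff_C_mul] at hi
  have hi' := right_ne_zero_of_mul hi
  rw [finsetSum_coeff] at hi'
  simp only [coeff_C_mul, coeff_X_pow, mul_ite, mul_one, mul_zero, sum_ite_eq] at hi'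
  rw [mem_filter]
  split_ifs at hi' with h
  · exact ⟨h, hi'⟩
  · exact absurd rfl hi'

/-- The kernel `∏ ℓ ∈ S, (q [x ℓ = y ℓ] - 1)`, which is up to scaling the kernel of a
projection on `X ^ n`. -/
def charKernel {X : Type} [DecidableEq X] {n : ℕ} (q : ℝ) (S : Finset (Fin n))
    (x y : Fin n → X) : ℝ :=
  ∏ ℓ ∈ S, (q * (if x ℓ = y ℓ then 1 else 0) - 1)

theorem sum_charKernel_mul {X : Type} [Fintype X] [DecidableEq X] {n : ℕ}
    (S : Finset (Fin n)) (x y : Fin n → X) :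
    ∑ z, charKernel (Fintype.card X) S x z * charKernel (Fintype.card X) S y z =
      (Fintype.card X : ℝ) ^ n * charKernel (Fintype.card X) S x y := by
  have huniv : ∀ x y : Fin n → X, charKernel (Fintype.card X) S x y =
      ∏ ℓ, if ℓ ∈ S then ((Fintype.card X : ℝ) * (if x ℓ = y ℓ then 1 else 0) - 1) else 1 := by
    intro x y
    rw [charKernel, Finset.prod_ite_mem, univ_inter]
  have hcard : (Fintype.card X : ℝ) ^ n = ∏ _ℓ : Fin n, (Fintype.card X : ℝ) := by simp
  rw [huniv x y, hcard, ← prod_mul_distrib]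
  simp_rw [huniv, ← prod_mul_distrib]
  have hfac := Finset.prod_univ_sum (fun _ : Fin n => (univ : Finset X)) (fun ℓ z =>
    (if ℓ ∈ S then ((Fintype.card X : ℝ) * (if x ℓ = z then 1 else 0) - 1) else 1) *
    (if ℓ ∈ S then ((Fintype.card X : ℝ) * (if y ℓ = z then 1 else 0) - 1) else 1))
  rw [Fintype.piFinset_univ] at hfac
  rw [← hfac]
  refine prod_congr rfl fun ℓ _ => ?_
  by_cases hℓ : ℓ ∈ S
  · simp only [hℓ, if_true, mul_sub, sub_mul, mul_one, one_mul, sum_sub_distrib]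
    have h1 : ∀ z : X, (Fintype.card X : ℝ) * (if x ℓ = z then 1 else 0) *
        ((Fintype.card X : ℝ) * (if y ℓ = z then 1 else 0)) =
        if y ℓ = z then
          (Fintype.card X : ℝ) * (Fintype.card X : ℝ) * (if x ℓ = y ℓ then 1 else 0) else 0 := by
      intro z
      by_cases hy : y ℓ = z
      · subst hy
        simp
      · simp [hy]
    simp only [h1, ← mul_sum, sum_ite_eq, mem_univ, if_true, sum_const, card_univ, nsmul_eq_mul]
    ring
  · simp [hℓ]

open Polynomial in
/-- The generating polynomial of the Krawtchouk kernels. -/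
def krawKernel {X : Type} [DecidableEq X] (q : ℝ) (x y : X) : ℝ[X] :=
  if x = y then 1 + C (q - 1) * Polynomial.X else 1 - Polynomial.X

open Polynomial in
theorem coeff_prod_krawKernel {X : Type} [DecidableEq X] {n : ℕ} (q : ℝ) (x y : Fin n → X)
    (i : ℕ) :
    (∏ ℓ, krawKernel q (x ℓ) (y ℓ)).coeff i =
      ∑ S ∈ powersetCard i univ, charKernel q S x y := by
  have h1 : ∀ ℓ, krawKernel q (x ℓ) (y ℓ) =
      C (q * (if x ℓ = y ℓ then 1 else 0) - 1) * Polynomial.X + 1 := by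
    intro ℓ
    unfold krawKernel
    split_ifs <;> simp <;> ring
  simp_rw [h1, prod_add_one, prod_mul_distrib, prod_const, finsetSum_coeff, ← map_prod,
    coeff_C_mul, coeff_X_pow]
  rw [powersetCard_eq_filter, sum_filter]
  refine sum_congr rfl fun S _ => ?_
  simp [charKernel, eq_comm]

open Polynomial in
theorem coeff_one_sub_X_pow (m h : ℕ) :
    ((1 - X : ℝ[X]) ^ m).coeff h = (-1) ^ h * (m.choose h : ℝ) := by
  have h1 : (1 - X : ℝ[X]) ^ m = ((1 + X) ^ m : ℝ[X]).comp (C (-1) * X) := by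
    simp [sub_eq_add_neg]
  rw [h1, comp_C_mul_X_coeff, coeff_one_add_X_pow]
  ring

open Polynomial in
theorem coeff_one_add_C_mul_X_pow (c : ℝ) (m h : ℕ) :
    ((1 + C c * X : ℝ[X]) ^ m).coeff h = c ^ h * (m.choose h : ℝ) := by
  have h1 : (1 + C c * X : ℝ[X]) ^ m = ((1 + X) ^ m : ℝ[X]).comp (C c * X) := by
    simp
  rw [h1, comp_C_mul_X_coeff, coeff_one_add_X_pow]
  ring

open Polynomial in
theorem coeff_prod_krawKernel_eq_kraw {X : Type} [DecidableEq X] {n : ℕ} (q : ℕ)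
    (x y : Fin n → X) (i : ℕ) :
    (∏ ℓ, krawKernel (q : ℝ) (x ℓ) (y ℓ)).coeff i = kraw q n i (hammingDist x y) := by
  have hcard : (univ.filter fun ℓ => x ℓ = y ℓ).card = n - hammingDist x y := by
    have h := card_filter_add_card_filter_not (s := (univ : Finset (Fin n)))
      (fun ℓ => x ℓ = y ℓ)
    rw [card_univ, Fintype.card_fin] at h
    have h' : (univ.filter fun ℓ => ¬ x ℓ = y ℓ).card = hammingDist x y := rfl
    omega
  have h1 : ∏ ℓ, krawKernel (q : ℝ) (x ℓ) (y ℓ) =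
      (1 - Polynomial.X) ^ hammingDist x y *
        (1 + C ((q : ℝ) - 1) * Polynomial.X) ^ (n - hammingDist x y) := by
    simp only [krawKernel]
    rw [prod_ite, prod_const, prod_const, hcard, mul_comm]
    rfl
  rw [h1, coeff_mul, Nat.sum_antidiagonal_eq_sum_range_succ_mk, kraw]
  refine sum_congr rfl fun h _ => ?_
  simp only [coeff_one_sub_X_pow, coeff_one_add_C_mul_X_pow]
  ring

/-- If the `i`-th component of the inner distribution transform vanishes, then so do all the
character sums over sets of size `i`. -/
theorem sum_charKernel_eq_zero {X : Type} [Fintype X] [DecidableEq X] {n : ℕ}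
    (hq : 0 < Fintype.card X) (C : Finset (Fin n → X)) {i : ℕ}
    (hB : ∑ x ∈ C, ∑ y ∈ C, kraw (Fintype.card X) n i (hammingDist x y) = 0)
    {S : Finset (Fin n)} (hS : S.card = i) (z : Fin n → X) :
    ∑ x ∈ C, charKernel (Fintype.card X) S x z = 0 := by
  have hsq : ∀ S : Finset (Fin n),
      ∑ z, (∑ x ∈ C, charKernel (Fintype.card X) S x z) ^ 2 =
        (Fintype.card X : ℝ) ^ n * ∑ x ∈ C, ∑ y ∈ C, charKernel (Fintype.card X) S x y := by
    intro S
    simp_rw [mul_sum, ← sum_charKernel_mul, sq, sum_mul_sum]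
    rw [sum_comm]
    refine sum_congr rfl fun x _ => ?_
    rw [sum_comm]
  have hpow : (0 : ℝ) < (Fintype.card X : ℝ) ^ n := pow_pos (by exact_mod_cast hq) n
  have htotal : ∑ S ∈ powersetCard i (univ : Finset (Fin n)),
      ∑ z, (∑ x ∈ C, charKernel (Fintype.card X) S x z) ^ 2 = 0 := by
    simp_rw [hsq, ← mul_sum]
    rw [sum_comm]
    simp_rw [sum_comm (s := powersetCard i (univ : Finset (Fin n))), ← coeff_prod_krawKernel,
      coeff_prod_krawKernel_eq_kraw, hB, mul_zero]
  have h1 := (sum_eq_zero_iff_of_nonneg fun S _ =>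
    sum_nonneg fun z _ => sq_nonneg _).1 htotal S (by simp [mem_powersetCard, hS])
  have h2 := (sum_eq_zero_iff_of_nonneg fun z _ => sq_nonneg _).1 h1 z (mem_univ z)
  exact pow_eq_zero_iff (two_ne_zero) |>.1 h2

/-- Polynomials supported on the indices where `B` does not vanish. -/
def supportedOn (B : ℕ → ℝ) : AddSubgroup (Polynomial ℝ) where
  carrier := {p | ∀ i, B i = 0 → p.coeff i = 0}
  zero_mem' := by simp
  add_mem' := by
    intro p r hp hr i hi
    simp [hp i hi, hr i hi]
  neg_mem' := by
    intro p hp i hi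
    simp [hp i hi]

theorem sum_prod_krawKernel_mem {X : Type} [Fintype X] [DecidableEq X] {n : ℕ}
    (hq : 0 < Fintype.card X) (C : Finset (Fin n → X)) (B : ℕ → ℝ)
    (hB : ∀ i, B i = ∑ x ∈ C, ∑ y ∈ C, kraw (Fintype.card X) n i (hammingDist x y))
    (z : Fin n → X) :
    ∑ x ∈ C, ∏ ℓ, krawKernel (Fintype.card X : ℝ) (x ℓ) (z ℓ) ∈ supportedOn B := by
  intro i hi
  rw [Polynomial.finsetSum_coeff]
  simp_rw [coeff_prod_krawKernel]
  rw [sum_comm]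
  refine sum_eq_zero fun S hS => ?_
  exact sum_charKernel_eq_zero hq C ((hB i).symm.trans hi) (mem_powersetCard.1 hS).2 z

open Polynomial in
/-- The image of the indicator of the base point under the generating kernel. -/
def baseKernel {X : Type} [DecidableEq X] (q : ℝ) (x₀ x : X) : ℝ[X] :=
  if x = x₀ then 1 + C (q - 1) * Polynomial.X else 1 - Polynomial.X

open Polynomial in
/-- The image of the indicator of the other points under the generating kernel. -/
def offBaseKernel {X : Type} [DecidableEq X] (q : ℝ) (x₀ x : X) : ℝ[X] :=
  if x = x₀ then C (q - 1) * (1 - Polynomial.X) else C (q - 1) + Polynomial.X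

open Polynomial in
theorem sum_erase_krawKernel {X : Type} [Fintype X] [DecidableEq X] (x₀ x : X) :
    ∑ z ∈ univ.erase x₀, krawKernel (Fintype.card X : ℝ) x z =
      offBaseKernel (Fintype.card X : ℝ) x₀ x := by
  have h : ∑ z, krawKernel (Fintype.card X : ℝ) x z = C (Fintype.card X : ℝ) := by
    have h1 : ∀ z, krawKernel (Fintype.card X : ℝ) x z =
        (if x = z then C (Fintype.card X : ℝ) * Polynomial.X else 0) + (1 - Polynomial.X) := by
      intro z
      unfold krawKernel
      split_ifs
      · simp
        ring
      · simp
    simp only [h1, sum_add_distrib, sum_ite_eq, mem_univ, if_true, sum_const, card_univ,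
      nsmul_eq_mul, map_natCast]
    ring
  rw [← sum_erase_add _ _ (mem_univ x₀)] at h
  rw [eq_sub_of_add_eq h, krawKernel, offBaseKernel]
  split_ifs <;> simp <;> ring

theorem sum_prod_offBaseKernel_mul_prod_baseKernel_mem {X : Type} [Fintype X] [DecidableEq X]
    {n : ℕ} (hq : 0 < Fintype.card X) (x₀ : X) (C : Finset (Fin n → X)) (B : ℕ → ℝ)
    (hB : ∀ i, B i = ∑ x ∈ C, ∑ y ∈ C, kraw (Fintype.card X) n i (hammingDist x y))
    (S : Finset (Fin n)) :
    ∑ x ∈ C, (∏ ℓ ∈ S, offBaseKernel (Fintype.card X : ℝ) x₀ (x ℓ)) *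
      ∏ ℓ ∈ Sᶜ, baseKernel (Fintype.card X : ℝ) x₀ (x ℓ) ∈ supportedOn B := by
  have h : ∀ x : Fin n → X, (∏ ℓ ∈ S, offBaseKernel (Fintype.card X : ℝ) x₀ (x ℓ)) *
      ∏ ℓ ∈ Sᶜ, baseKernel (Fintype.card X : ℝ) x₀ (x ℓ) =
      ∑ z ∈ Fintype.piFinset (fun ℓ => if ℓ ∈ S then univ.erase x₀ else {x₀}),
        ∏ ℓ, krawKernel (Fintype.card X : ℝ) (x ℓ) (z ℓ) := by
    intro x
    rw [← prod_univ_sum (fun ℓ => if ℓ ∈ S then univ.erase x₀ else {x₀})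
      (fun ℓ z => krawKernel (Fintype.card X : ℝ) (x ℓ) z), ← prod_mul_prod_compl S]
    congr 1
    · refine prod_congr rfl fun ℓ hℓ => ?_
      rw [if_pos hℓ, sum_erase_krawKernel]
    · refine prod_congr rfl fun ℓ hℓ => ?_
      rw [if_neg (mem_compl.1 hℓ), sum_singleton]
      rfl
  simp_rw [h]
  rw [sum_comm]
  exact AddSubgroup.sum_mem _ fun z _ => sum_prod_krawKernel_mem hq C B hB z

/-- The points of a list of pairs. -/
def pairPoints {α : Type} : List (α × α) → List α
  | [] => []
  | p :: L => p.1 :: p.2 :: pairPoints L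

theorem length_pairPoints {α : Type} (L : List (α × α)) :
    (pairPoints L).length = 2 * L.length := by
  induction L with
  | nil => rfl
  | cons p L ih =>
    simp only [pairPoints, List.length_cons, ih]
    ring

/-- The product over a list of pairs `(a, b)` of the minors `g₁ a * g₀ b - g₀ a * g₁ b`. -/
def minorProd {α R : Type} [CommRing R] (g₀ g₁ : α → R) : List (α × α) → R
  | [] => 1
  | p :: L => (g₁ p.1 * g₀ p.2 - g₀ p.1 * g₁ p.2) * minorProd g₀ g₁ L

/-- Expanding the minors shows that a subgroup containing all the products of entries contains
the products of minors. -/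
theorem sum_minorProd_mem {ι α R : Type} [Fintype α] [DecidableEq α] [CommRing R]
    (K : AddSubgroup R) (C : Finset ι) (g₀ g₁ : ι → α → R)
    (hK : ∀ S : Finset α, ∑ x ∈ C, (∏ ℓ ∈ S, g₁ x ℓ) * ∏ ℓ ∈ Sᶜ, g₀ x ℓ ∈ K)
    (L : List (α × α)) (hL : (pairPoints L).Nodup) (S : Finset α)
    (hS : ∀ ℓ ∈ pairPoints L, ℓ ∉ S) :
    ∑ x ∈ C, (∏ ℓ ∈ S, g₁ x ℓ) * minorProd (g₀ x) (g₁ x) L *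
      ∏ ℓ ∈ (S ∪ (pairPoints L).toFinset)ᶜ, g₀ x ℓ ∈ K := by
  induction L generalizing S with
  | nil => simpa [pairPoints, minorProd] using hK S
  | cons p L ih =>
    obtain ⟨a, b⟩ := p
    simp only [pairPoints, List.nodup_cons, List.mem_cons, not_or] at hL hS
    obtain ⟨⟨hab, haL⟩, hbL, hL⟩ := hL
    have haS : a ∉ S := hS a (Or.inl rfl)
    have hbS : b ∉ S := hS b (Or.inr (Or.inl rfl))
    set U := (S ∪ (pairPoints ((a, b) :: L)).toFinset)ᶜ with hU
    have haU : a ∉ U := by simp [hU, pairPoints]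
    have hbU : b ∉ U := by simp [hU, pairPoints]
    have hUa : (insert a S ∪ (pairPoints L).toFinset)ᶜ = insert b U := by
      ext ℓ
      simp only [hU, pairPoints, List.toFinset_cons, mem_compl, mem_union, mem_insert,
        List.mem_toFinset, not_or]
      by_cases hℓ : ℓ = b
      · subst hℓ
        simp [hbS, hbL, Ne.symm hab]
      · simp only [hℓ, not_false_eq_true, true_and, false_or]
        tauto
    have hUb : (insert b S ∪ (pairPoints L).toFinset)ᶜ = insert a U := by
      ext ℓ
      simp only [hU, pairPoints, List.toFinset_cons, mem_compl, mem_union, mem_insert,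
        List.mem_toFinset, not_or]
      by_cases hℓ : ℓ = a
      · subst hℓ
        simp [haS, haL, hab]
      · simp only [hℓ, not_false_eq_true, true_and, false_or]
        tauto
    have h1 := ih hL (insert a S) fun ℓ hℓ hmem => (mem_insert.1 hmem).elim
      (fun h => haL (h ▸ hℓ)) (hS ℓ (Or.inr (Or.inr hℓ)))
    have h2 := ih hL (insert b S) fun ℓ hℓ hmem => (mem_insert.1 hmem).elim
      (fun h => hbL (h ▸ hℓ)) (hS ℓ (Or.inr (Or.inr hℓ)))
    rw [hUa] at h1
    rw [hUb] at h2
    simp only [prod_insert haS, prod_insert hbS, prod_insert haU, prod_insert hbU] at h1 h2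
    convert K.sub_mem h1 h2 using 1
    rw [← sum_sub_distrib]
    refine sum_congr rfl fun x _ => ?_
    rw [minorProd]
    ring

/-- The indicator of the support of a word. -/
def suppInd {X : Type} [DecidableEq X] {n : ℕ} (x₀ : X) (x : Fin n → X) (ℓ : Fin n) : ℝ :=
  if x ℓ = x₀ then 0 else 1

/-- The harmonic function attached to a list of pairs `(a, b)`: the product of the differences of
the indicators of `a` and `b` belonging to the support. -/
def pairDiffProd {X : Type} [DecidableEq X] {n : ℕ} (x₀ : X) (x : Fin n → X) :
    List (Fin n × Fin n) → ℝ
  | [] => 1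
  | p :: L => (suppInd x₀ x p.1 - suppInd x₀ x p.2) * pairDiffProd x₀ x L

theorem sum_suppInd {X : Type} [DecidableEq X] {n : ℕ} (x₀ : X) (x : Fin n → X)
    (S : Finset (Fin n)) :
    ∑ ℓ ∈ S, suppInd x₀ x ℓ = ((S.filter fun ℓ => x ℓ ≠ x₀).card : ℝ) := by
  rw [card_filter, Nat.cast_sum]
  refine sum_congr rfl fun ℓ _ => ?_
  by_cases h : x ℓ = x₀ <;> simp [suppInd, h]

theorem prod_suppInd {X : Type} [DecidableEq X] {n : ℕ} (x₀ : X) (x : Fin n → X)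
    (S : Finset (Fin n)) :
    ∏ ℓ ∈ S, suppInd x₀ x ℓ = if S ⊆ supp x₀ x then 1 else 0 := by
  split_ifs with h
  · refine prod_eq_one fun ℓ hℓ => ?_
    have := h hℓ
    rw [supp, mem_filter] at this
    simp [suppInd, this.2]
  · obtain ⟨ℓ, hℓ, hx⟩ := not_subset.1 h
    refine prod_eq_zero hℓ ?_
    simpa [supp, suppInd] using hx

/-- Where the harmonic function is nonzero, the support contains exactly one point of each
pair. -/
theorem card_filter_pairPoints {X : Type} [DecidableEq X] {n : ℕ} {x₀ : X} {x : Fin n → X}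
    {L : List (Fin n × Fin n)} (hL : (pairPoints L).Nodup) (h : pairDiffProd x₀ x L ≠ 0) :
    ((pairPoints L).toFinset.filter fun ℓ => x ℓ ≠ x₀).card = L.length := by
  induction L with
  | nil => simp [pairPoints]
  | cons p L ih =>
    obtain ⟨a, b⟩ := p
    simp only [pairPoints, List.nodup_cons, List.mem_cons, not_or] at hL
    obtain ⟨⟨hab, haL⟩, hbL, hL⟩ := hL
    rw [pairDiffProd] at h
    have hne := left_ne_zero_of_mul h
    have ih' := ih hL (right_ne_zero_of_mul h)
    simp only [pairPoints, List.toFinset_cons, filter_insert, List.length_cons]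
    by_cases ha : x a = x₀ <;> by_cases hb : x b = x₀
    · simp [suppInd, ha, hb] at hne
    · rw [if_neg (by simpa using ha), if_pos hb, card_insert_of_notMem (by simp [hbL]), ih']
    · rw [if_pos ha, if_neg (by simpa using hb), card_insert_of_notMem (by simp [haL]), ih']
    · simp [suppInd, ha, hb] at hne

theorem card_compl_filter_pairPoints {X : Type} [DecidableEq X] {n : ℕ} {x₀ : X}
    {x : Fin n → X} {L : List (Fin n × Fin n)} (hL : (pairPoints L).Nodup)
    (h : pairDiffProd x₀ x L ≠ 0) :
    wt x₀ x = L.length + (((pairPoints L).toFinsetᶜ).filter fun ℓ => x ℓ ≠ x₀).card := by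
  rw [← card_filter_pairPoints hL h, wt, ← card_union_of_disjoint, ← filter_union,
    union_compl]
  exact disjoint_filter_filter disjoint_compl_right

theorem card_compl_pairPoints {n : ℕ} {L : List (Fin n × Fin n)} (hL : (pairPoints L).Nodup) :
    (pairPoints L).toFinsetᶜ.card = n - 2 * L.length := by
  rw [card_compl, Fintype.card_fin, List.toFinset_card_of_nodup hL, length_pairPoints]

theorem two_mul_length_le {n : ℕ} {L : List (Fin n × Fin n)} (hL : (pairPoints L).Nodup) :
    2 * L.length ≤ n := by
  have := hL.length_le_card
  rwa [length_pairPoints, Fintype.card_fin] at this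

open Polynomial in
theorem minorProd_baseKernel {X : Type} [DecidableEq X] {n : ℕ} (q : ℝ) (x₀ : X)
    (x : Fin n → X) (L : List (Fin n × Fin n)) :
    minorProd (fun ℓ => baseKernel q x₀ (x ℓ)) (fun ℓ => offBaseKernel q x₀ (x ℓ)) L =
      C (q ^ (2 * L.length)) * Polynomial.X ^ L.length * C (pairDiffProd x₀ x L) := by
  induction L with
  | nil => simp [minorProd, pairDiffProd]
  | cons p L ih =>
    have h : offBaseKernel q x₀ (x p.1) * baseKernel q x₀ (x p.2) -
        baseKernel q x₀ (x p.1) * offBaseKernel q x₀ (x p.2) =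
        C (q ^ 2) * Polynomial.X * C (suppInd x₀ x p.1 - suppInd x₀ x p.2) := by
      unfold offBaseKernel baseKernel suppInd
      split_ifs <;> simp <;> ring
    rw [minorProd, ih, h, pairDiffProd, List.length_cons, mul_add, pow_add q, pow_succ]
    simp only [C_mul]
    ring

open Polynomial in
/-- The MacWilliams identity for a code weighted by a harmonic function. -/
theorem sum_minorProd_eq_macWilliams {X : Type} [DecidableEq X] {n : ℕ} (q : ℝ) (x₀ : X)
    (D : Finset (Fin n → X)) {L : List (Fin n × Fin n)} (hL : (pairPoints L).Nodup) :
    ∑ x ∈ D, minorProd (fun ℓ => baseKernel q x₀ (x ℓ)) (fun ℓ => offBaseKernel q x₀ (x ℓ)) L *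
        ∏ ℓ ∈ (pairPoints L).toFinsetᶜ, baseKernel q x₀ (x ℓ) =
      C (q ^ (2 * L.length)) * Polynomial.X ^ L.length *
        macWilliams q (n - 2 * L.length)
          (fun j => ∑ x ∈ D with wt x₀ x = L.length + j, pairDiffProd x₀ x L) := by
  have hrhs : macWilliams q (n - 2 * L.length)
      (fun j => ∑ x ∈ D with wt x₀ x = L.length + j, pairDiffProd x₀ x L) =
      ∑ x ∈ D, ∑ j ∈ range (n - 2 * L.length + 1), if wt x₀ x = L.length + j then
        C (pairDiffProd x₀ x L) * ((1 + C (q - 1) * Polynomial.X) ^ (n - 2 * L.length - j) *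
          (1 - Polynomial.X) ^ j) else 0 := by
    rw [macWilliams, sum_comm]
    refine sum_congr rfl fun j _ => ?_
    rw [map_sum, sum_mul, sum_filter]
  rw [hrhs, mul_sum]
  refine sum_congr rfl fun x _ => ?_
  rw [minorProd_baseKernel, mul_assoc (C (q ^ (2 * L.length)) * Polynomial.X ^ L.length)]
  congr 1
  by_cases h : pairDiffProd x₀ x L = 0
  · simp [h]
  have hwt := card_compl_filter_pairPoints hL h
  set m := (((pairPoints L).toFinsetᶜ).filter fun ℓ => x ℓ ≠ x₀).card with hm
  have hcard := card_filter_add_card_filter_not (s := (pairPoints L).toFinsetᶜ)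
    (fun ℓ => x ℓ = x₀)
  rw [card_compl_pairPoints hL] at hcard
  have hprod : ∏ ℓ ∈ (pairPoints L).toFinsetᶜ, baseKernel q x₀ (x ℓ) =
      (1 + C (q - 1) * Polynomial.X) ^ (n - 2 * L.length - m) * (1 - Polynomial.X) ^ m := by
    simp only [baseKernel]
    rw [prod_ite, prod_const, prod_const]
    congr 2
    exact (Nat.sub_eq_of_eq_add hcard.symm).symm
  simp only [hprod, hwt, add_right_inj]
  rw [sum_ite_eq, if_pos]
  rw [mem_range, Nat.lt_succ_iff, ← hcard]
  exact Nat.le_add_left _ _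

/-- If the harmonic sums over words of constant weight `k` vanish, then they still vanish after
multiplying by the indicator of the support containing a set disjoint from the pairs. -/
theorem sum_prod_suppInd_mul_pairDiffProd_eq_zero {X : Type} [DecidableEq X] {n : ℕ} {x₀ : X}
    {D : Finset (Fin n → X)} {k t : ℕ} (hD : ∀ x ∈ D, wt x₀ x = k)
    (hvan : ∀ L : List (Fin n × Fin n), (pairPoints L).Nodup → L ≠ [] → L.length ≤ t →
      ∑ x ∈ D, pairDiffProd x₀ x L = 0)
    (T : Finset (Fin n)) (L : List (Fin n × Fin n)) (hL : (pairPoints L).Nodup) (hne : L ≠ [])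
    (hT : ∀ ℓ ∈ pairPoints L, ℓ ∉ T) (hcard : T.card + L.length ≤ t) :
    ∑ x ∈ D, (∏ ℓ ∈ T, suppInd x₀ x ℓ) * pairDiffProd x₀ x L = 0 := by
  induction T using Finset.induction_on generalizing L with
  | empty => simpa using hvan L hL hne (by simpa using hcard)
  | insert ℓ T hℓ ih =>
    rw [card_insert_of_notMem hℓ] at hcard
    have hℓL : ℓ ∉ pairPoints L := fun h => hT ℓ h (mem_insert_self ℓ T)
    have hTL : ∀ i ∈ pairPoints L, i ∉ T := fun i hi h => hT i hi (mem_insert_of_mem h)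
    set U := (T ∪ (pairPoints L).toFinset)ᶜ with hU
    have hexch : ∀ i ∈ U, ∑ x ∈ D, (∏ j ∈ insert i T, suppInd x₀ x j) * pairDiffProd x₀ x L =
        ∑ x ∈ D, (∏ j ∈ insert ℓ T, suppInd x₀ x j) * pairDiffProd x₀ x L := by
      intro i hi
      rw [hU, mem_compl, mem_union, List.mem_toFinset, not_or] at hi
      by_cases hiℓ : i = ℓ
      · rw [hiℓ]
      have h := ih ((i, ℓ) :: L) (by simp [pairPoints, hiℓ, hi.2, hℓL, hL]) (by simp) (by
        intro j hj
        simp only [pairPoints, List.mem_cons] at hj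
        rcases hj with rfl | rfl | hj
        · exact hi.1
        · exact hℓ
        · exact hTL j hj) (by simp only [List.length_cons]; omega)
      rw [← sub_eq_zero, ← sum_sub_distrib, ← h]
      refine sum_congr rfl fun x _ => ?_
      rw [prod_insert hi.1, prod_insert hℓ, pairDiffProd]
      ring
    have hsum : ∑ i ∈ U, ∑ x ∈ D, (∏ j ∈ insert i T, suppInd x₀ x j) * pairDiffProd x₀ x L =
        ((k : ℝ) - T.card - L.length) *
          ∑ x ∈ D, (∏ j ∈ T, suppInd x₀ x j) * pairDiffProd x₀ x L := by
      rw [sum_comm, mul_sum]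
      refine sum_congr rfl fun x hx => ?_
      have h1 : ∑ i ∈ U, (∏ j ∈ insert i T, suppInd x₀ x j) * pairDiffProd x₀ x L =
          (∑ i ∈ U, suppInd x₀ x i) * ((∏ j ∈ T, suppInd x₀ x j) * pairDiffProd x₀ x L) := by
        rw [sum_mul]
        refine sum_congr rfl fun i hi => ?_
        rw [hU, mem_compl, mem_union, not_or] at hi
        rw [prod_insert hi.1, mul_assoc]
      rw [h1]
      by_cases h : (∏ j ∈ T, suppInd x₀ x j) * pairDiffProd x₀ x L = 0
      · rw [h, mul_zero, mul_zero]
      congr 1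
      have hTx : T ⊆ supp x₀ x := by
        by_contra hTx
        exact h (by rw [prod_suppInd, if_neg hTx, zero_mul])
      have hT1 : ∑ i ∈ T, suppInd x₀ x i = T.card := by
        rw [sum_suppInd, filter_true_of_mem fun i hi => (mem_filter.1 (hTx hi)).2]
      have hL1 : ∑ i ∈ (pairPoints L).toFinset, suppInd x₀ x i = L.length := by
        rw [sum_suppInd, card_filter_pairPoints hL (right_ne_zero_of_mul h)]
      have htot : ∑ i, suppInd x₀ x i = k := by
        rw [sum_suppInd, ← hD x hx, wt]
      rw [← sum_add_sum_compl (T ∪ (pairPoints L).toFinset), sum_union, hT1, hL1] at htot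
      · rw [hU, ← htot]
        ring
      · exact disjoint_left.2 fun i hi hiL => hTL i (List.mem_toFinset.1 hiL) hi
    rw [sum_congr rfl hexch, sum_const, ih L hL hne hTL (by omega), mul_zero, nsmul_eq_mul,
      mul_eq_zero] at hsum
    refine hsum.resolve_left ?_
    have hmem : ℓ ∈ U := by simp [hU, hℓ, hℓL]
    exact_mod_cast (card_pos.2 ⟨ℓ, hmem⟩).ne'

/-- A function on sets of size `t` that is invariant under exchanging one element is constant. -/
theorem eq_of_exchange {α β : Type} [DecidableEq α] {t : ℕ} (F : Finset α → β)
    (hF : ∀ (T : Finset α) (a b : α), T.card + 1 = t → a ∉ T → b ∉ T → a ≠ b →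
      F (insert a T) = F (insert b T)) {T T' : Finset α} (hT : T.card = t) (hT' : T'.card = t) :
    F T = F T' := by
  induction hm : (T \ T').card generalizing T with
  | zero =>
    rw [card_eq_zero, sdiff_eq_empty_iff_subset] at hm
    rw [eq_of_subset_of_card_le hm (by omega)]
  | succ m ih =>
    obtain ⟨a, ha⟩ : (T \ T').Nonempty := card_pos.1 (by omega)
    obtain ⟨b, hb⟩ : (T' \ T).Nonempty := by
      have h1 := card_sdiff_add_card_inter T T'
      have h2 := card_sdiff_add_card_inter T' T
      rw [inter_comm] at h2
      exact card_pos.1 (by omega)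
    rw [mem_sdiff] at ha hb
    have hab : a ≠ b := by
      rintro rfl
      exact ha.2 hb.1
    have hb' : b ∉ T.erase a := fun h => hb.2 (mem_of_mem_erase h)
    have hcard := card_erase_add_one ha.1
    have h := hF (T.erase a) a b (hcard.trans hT) (notMem_erase a T) hb' hab
    rw [insert_erase ha.1] at h
    rw [h]
    refine ih (by rw [card_insert_of_notMem hb', hcard, hT]) ?_
    rw [insert_sdiff_of_mem _ hb.1, erase_sdiff_comm, card_erase_of_mem (mem_sdiff.2 ha), hm]
    rfl

/-- Vanishing of the harmonic sums of degrees `1, …, t` makes the supports of the words of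
constant weight a `t`-design. -/
theorem exists_card_filter_subset_supp_eq {X : Type} [DecidableEq X] {n : ℕ} {x₀ : X}
    {D : Finset (Fin n → X)} {k t : ℕ} (hD : ∀ x ∈ D, wt x₀ x = k)
    (hvan : ∀ L : List (Fin n × Fin n), (pairPoints L).Nodup → L ≠ [] → L.length ≤ t →
      ∑ x ∈ D, pairDiffProd x₀ x L = 0) (htn : t ≤ n) :
    ∃ lam : ℕ, ∀ T : Finset (Fin n), T.card = t →
      (D.filter fun x => T ⊆ supp x₀ x).card = lam := by
  obtain ⟨T₀, -, hT₀⟩ := exists_subset_card_eq (s := (univ : Finset (Fin n))) (n := t)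
    (by simpa using htn)
  refine ⟨_, fun T hT => eq_of_exchange (fun T => (D.filter fun x => T ⊆ supp x₀ x).card)
    (fun T a b hcard ha hb hab => ?_) hT hT₀⟩
  have hcount : ∀ T : Finset (Fin n), ((D.filter fun x => T ⊆ supp x₀ x).card : ℝ) =
      ∑ x ∈ D, ∏ ℓ ∈ T, suppInd x₀ x ℓ := by
    intro T
    simp_rw [prod_suppInd]
    rw [sum_boole]
  have h := sum_prod_suppInd_mul_pairDiffProd_eq_zero hD hvan T [(a, b)]
    (by simp [pairPoints, hab]) (by simp) (by simp [pairPoints, ha, hb]) (by simp [hcard])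
  have h' : ((D.filter fun x => insert a T ⊆ supp x₀ x).card : ℝ) =
      ((D.filter fun x => insert b T ⊆ supp x₀ x).card : ℝ) := by
    rw [hcount, hcount, ← sub_eq_zero, ← sum_sub_distrib, ← h]
    refine sum_congr rfl fun x _ => ?_
    rw [prod_insert ha, prod_insert hb, pairDiffProd, pairDiffProd]
    ring
  exact_mod_cast h'

/-- **Assmus–Mattson theorem for the Hamming association scheme** (Tanaka). -/
theorem assmus_mattson_hamming {X : Type} [Fintype X] [DecidableEq X]
    (hq : 2 ≤ Fintype.card X) (x₀ : X) {n : ℕ} (hn : 2 ≤ n)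
    (C : Finset (Fin n → X)) (hC1 : 1 < C.card) (hC2 : C.card < Fintype.card X ^ n)
    (B : ℕ → ℝ)
    (hB : ∀ i, B i = ∑ x ∈ C, ∑ y ∈ C, kraw (Fintype.card X) n i (hammingDist x y))
    (δ δs : ℕ)
    (hδ : δ = sInf {i | 1 ≤ i ∧ i ≤ n ∧ ∃ x ∈ C, wt x₀ x = i})
    (hδs : δs = sInf {i | 1 ≤ i ∧ i ≤ n ∧ B i ≠ 0})
    (t : ℕ) (ht1 : 1 ≤ t) (htn : t ≤ n)
    (hyp : ∀ r : ℕ, 1 ≤ r → r ≤ t →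
      ((((Finset.Icc r (n - r)).filter fun i => ∃ x ∈ C, wt x₀ x = i).card : ℤ)
          ≤ (δs : ℤ) - (r : ℤ)) ∨
      ((((Finset.Icc r (n - r)).filter fun i => B i ≠ 0).card : ℤ)
          ≤ (δ : ℤ) - (r : ℤ))) :
    ∀ i : ℕ, i ≤ n →
      ∃ lam : ℕ, ∀ T : Finset (Fin n), T.card = t →
        (C.filter fun x => wt x₀ x = i ∧ T ⊆ supp x₀ x).card = lam := by
  have hq0 : 0 < Fintype.card X := by omega
  have hqne : (Fintype.card X : ℝ) ≠ 0 := by exact_mod_cast hq0.ne'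
  have hnat : ∀ c d r : ℕ, (c : ℤ) ≤ d - r → c ≤ d - r := by omega
  have hδ0 : ∀ k, 1 ≤ k → k < δ → ∀ x ∈ C, wt x₀ x ≠ k := by
    intro k hk hkδ x hx hw
    have hwn : wt x₀ x ≤ n := by
      simpa [wt] using card_filter_le (univ : Finset (Fin n)) fun ℓ => x ℓ ≠ x₀
    rw [hδ] at hkδ
    exact Nat.notMem_of_lt_sInf hkδ ⟨hk, hw ▸ hwn, x, hx, hw⟩
  have hδs0 : ∀ i, 1 ≤ i → i ≤ n → i < δs → B i = 0 := by
    intro i hi hin hiδ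
    rw [hδs] at hiδ
    by_contra h
    exact Nat.notMem_of_lt_sInf hiδ ⟨hi, hin, h⟩
  have hvan : ∀ L : List (Fin n × Fin n), (pairPoints L).Nodup → L ≠ [] → L.length ≤ t →
      ∀ k, ∑ x ∈ C with wt x₀ x = k, pairDiffProd x₀ x L = 0 := by
    intro L hL hne hLt k
    have hr : 1 ≤ L.length := List.length_pos_iff.2 hne
    have h2r := two_mul_length_le hL
    have hcoeff : ∀ i, B (i + L.length) = 0 → (macWilliams (Fintype.card X) (n - 2 * L.length)
        fun j => ∑ x ∈ C with wt x₀ x = L.length + j, pairDiffProd x₀ x L).coeff i = 0 := by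
      intro i hi
      have hmem := sum_minorProd_mem (supportedOn B) C
        (fun x ℓ => baseKernel (Fintype.card X : ℝ) x₀ (x ℓ))
        (fun x ℓ => offBaseKernel (Fintype.card X : ℝ) x₀ (x ℓ))
        (sum_prod_offBaseKernel_mul_prod_baseKernel_mem hq0 x₀ C B hB) L hL ∅ (by simp)
      simp only [prod_empty, one_mul, empty_union] at hmem
      rw [sum_minorProd_eq_macWilliams _ _ _ hL] at hmem
      have h := hmem _ hi
      rw [mul_assoc, Polynomial.coeff_C_mul, Polynomial.coeff_X_pow_mul, mul_eq_zero] at h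
      exact h.resolve_left (pow_ne_zero _ hqne)
    have hzero : ∀ j ≤ n - 2 * L.length,
        ∑ x ∈ C with wt x₀ x = L.length + j, pairDiffProd x₀ x L = 0 := by
      intro j hj
      rcases hyp L.length hr hLt with h | h
      · refine eq_zero_of_coeff_macWilliams_eq_zero (d := δs - L.length)
          (a := fun j => ∑ x ∈ C with wt x₀ x = L.length + j, pairDiffProd x₀ x L)
          hqne (fun i hi => ?_) ?_ hj
        · by_cases hin : i + L.length ≤ n
          · exact hcoeff i (hδs0 _ (by omega) hin (by omega))
          · exact Polynomial.coeff_eq_zero_of_natDegree_lt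
              ((natDegree_macWilliams_le _ _ _).trans_lt (by omega))
        · refine le_trans (card_le_card_of_injOn (fun j => L.length + j) ?_
            (add_right_injective _).injOn) (hnat _ _ _ h)
          intro i hi
          obtain ⟨hi1, hi2⟩ := mem_filter.1 hi
          obtain ⟨x, hx, -⟩ := exists_ne_zero_of_sum_ne_zero hi2
          have := mem_range.1 hi1
          exact mem_filter.2 ⟨mem_Icc.2 ⟨Nat.le_add_right _ _, by beta_reduce; omega⟩, x, mem_filter.1 hx⟩
      · refine eq_zero_of_card_support_macWilliams_le (d := δ - L.length)
          (a := fun j => ∑ x ∈ C with wt x₀ x = L.length + j, pairDiffProd x₀ x L)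
          hqne (fun i hi => ?_) ?_ hj
        · refine sum_eq_zero fun x hx => ?_
          obtain ⟨hxC, hxw⟩ := mem_filter.1 hx
          exact absurd hxw (hδ0 _ (by omega) (by omega) x hxC)
        · refine le_trans (card_le_card_of_injOn (fun j => L.length + j) ?_
            (add_right_injective _).injOn) (hnat _ _ _ h)
          intro i hi
          have hi0 := Polynomial.mem_support_iff.1 hi
          have hiN := (Polynomial.le_natDegree_of_mem_supp i hi).trans
            (natDegree_macWilliams_le _ _ _)
          refine mem_filter.2 ⟨mem_Icc.2 ⟨Nat.le_add_right _ _, by beta_reduce; omega⟩, fun hBi => hi0 ?_⟩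
          exact hcoeff i (by rwa [add_comm])
    by_cases hk : L.length ≤ k ∧ k ≤ n - L.length
    · have := hzero (k - L.length) (by omega)
      rwa [Nat.add_sub_cancel' hk.1] at this
    · refine sum_eq_zero fun x hx => ?_
      by_contra h
      have hw := card_compl_filter_pairPoints hL h
      have hle := card_filter_le ((pairPoints L).toFinsetᶜ) fun ℓ => x ℓ ≠ x₀
      rw [card_compl_pairPoints hL] at hle
      rw [(mem_filter.1 hx).2] at hw
      omega
  intro i _
  obtain ⟨lam, hlam⟩ := exists_card_filter_subset_supp_eq (x₀ := x₀)
    (D := C.filter fun x => wt x₀ x = i) (fun x hx => (mem_filter.1 hx).2)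
    (fun L hL hne hLt => hvan L hL hne hLt i) htn
  exact ⟨lam, fun T hT => by rw [← hlam T hT, filter_filter]⟩
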